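/- Let d ≥ 2, α ∈ (0,2), and let ℓ be a regular global modulus of continuity. Then there exist constants λ₂' > 0 and C > 1 such that for every R ∈ (0,1], every nonnegative function h that is α-harmonic in D_{−ℓ} ∩ B(0,R) and vanishes continuously on B(0,R) \ D_{−ℓ}, and every r ∈ (0, R/2]: h(r·e_d) ≥ C^{-1} (r/R)^{α/2} exp(λ₂' ∫_r^R ℓ(u)/u du) · h((R/2)·e_d). -/

import Mathlib

open Metric MeasureTheory

/-- `gEll ℓ t = t·ℓ(t)` for `t > 0`, and `0` for `t ≤ 0`. -/
noncomputable def gEll (ℓ : ℝ → ℝ) (t : ℝ) : ℝ := if 0 < t then t * ℓ t else 0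

/-- The special open set `D_{-ℓ} = {x : x_d > -Γ_ℓ(x̃)}`. -/
noncomputable def Dm (d : ℕ) (h0 : 0 < d) (ℓ : ℝ → ℝ) : Set (EuclideanSpace ℝ (Fin d)) :=
  {x | -gEll ℓ (x ⟨0, h0⟩) < x ⟨d - 1, Nat.sub_lt h0 Nat.one_pos⟩}

/-- `h` is `α`-harmonic in `U`: the Poisson-kernel mean value property holds on every ball
whose closure is contained in `U`. -/
def AlphaHarmonicOn (d : ℕ) (α : ℝ) (h : EuclideanSpace ℝ (Fin d) → ℝ)
    (U : Set (EuclideanSpace ℝ (Fin d))) : Prop :=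
  ∀ x₀ : EuclideanSpace ℝ (Fin d), ∀ ρ : ℝ, 0 < ρ → closedBall x₀ ρ ⊆ U →
    ∀ x ∈ ball x₀ ρ,
      IntegrableOn
        (fun y : EuclideanSpace ℝ (Fin d) =>
          ((ρ ^ 2 - dist x x₀ ^ 2) / (dist y x₀ ^ 2 - ρ ^ 2)) ^ (α / 2) *
            dist x y ^ (-(d : ℝ)) * h y)
        {y : EuclideanSpace ℝ (Fin d) | ρ < dist y x₀} ∧
      h x = Real.Gamma ((d : ℝ) / 2) * Real.pi ^ (-(d : ℝ) / 2 - 1) *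
          Real.sin (Real.pi * α / 2) *
        ∫ y in {y : EuclideanSpace ℝ (Fin d) | ρ < dist y x₀},
          ((ρ ^ 2 - dist x x₀ ^ 2) / (dist y x₀ ^ 2 - ρ ^ 2)) ^ (α / 2) *
            dist x y ^ (-(d : ℝ)) * h y

/-- The normalizing constant of the Poisson kernel of a ball. -/
noncomputable def poissonConst (d : ℕ) (α : ℝ) : ℝ :=
  Real.Gamma ((d : ℝ) / 2) * Real.pi ^ (-(d : ℝ) / 2 - 1) * Real.sin (Real.pi * α / 2)

/-- The unnormalized Poisson kernel of the ball of center `x₀` and radius `ρ`. -/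
noncomputable def poissonKer (d : ℕ) (α : ℝ) (x₀ : EuclideanSpace ℝ (Fin d)) (ρ : ℝ)
    (x y : EuclideanSpace ℝ (Fin d)) : ℝ :=
  ((ρ ^ 2 - dist x x₀ ^ 2) / (dist y x₀ ^ 2 - ρ ^ 2)) ^ (α / 2) * dist x y ^ (-(d : ℝ))

theorem poissonConst_pos {d : ℕ} (hd : 0 < d) {α : ℝ} (hα : α ∈ Set.Ioo (0 : ℝ) 2) :
    0 < poissonConst d α := by
  have h1 : 0 < Real.sin (Real.pi * α / 2) :=
    Real.sin_pos_of_pos_of_lt_pi (by have := Real.pi_pos; have := hα.1; positivity)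
      (by nlinarith [Real.pi_pos, hα.2])
  have h2 : 0 < Real.Gamma ((d : ℝ) / 2) := Real.Gamma_pos_of_pos (by positivity)
  unfold poissonConst
  positivity

/-- A kernel bound from bounds on the distances that enter it. -/
theorem le_poissonKer {d : ℕ} {α : ℝ} (hα : 0 < α) {x₀ x y : EuclideanSpace ℝ (Fin d)}
    {ρ a A B : ℝ} (ha : 0 ≤ a) (hax : a ≤ ρ ^ 2 - dist x x₀ ^ 2)
    (hρ : 0 < ρ) (hx : dist x x₀ < ρ) (hy : ρ < dist y x₀)
    (hA : dist y x₀ ^ 2 - ρ ^ 2 ≤ A) (hB : dist x y ≤ B) :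
    (a / A) ^ (α / 2) * B ^ (-(d : ℝ)) ≤ poissonKer d α x₀ ρ x y := by
  have h1 : 0 < dist y x₀ ^ 2 - ρ ^ 2 := by nlinarith
  have h2 : 0 < dist x y := by
    have := dist_triangle_left y x₀ x
    linarith
  have h3 : B ^ (-(d : ℝ)) ≤ dist x y ^ (-(d : ℝ)) :=
    Real.rpow_le_rpow_of_nonpos h2 hB (by simp)
  have h4 : (a / A) ^ (α / 2) ≤
      ((ρ ^ 2 - dist x x₀ ^ 2) / (dist y x₀ ^ 2 - ρ ^ 2)) ^ (α / 2) := by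
    apply Real.rpow_le_rpow
    · exact div_nonneg ha (h1.le.trans hA)
    · exact div_le_div₀ (ha.trans hax) hax h1 hA
    · positivity
  unfold poissonKer
  have h5 : 0 ≤ (a / A) ^ (α / 2) := Real.rpow_nonneg (div_nonneg ha (h1.le.trans hA)) _
  have h6 : 0 ≤ B ^ (-(d : ℝ)) := Real.rpow_nonneg (h2.le.trans hB) _
  exact mul_le_mul h4 h3 h6 (h5.trans h4)

theorem poissonKer_nonneg {d : ℕ} {α : ℝ} {x₀ x y : EuclideanSpace ℝ (Fin d)}
    {ρ : ℝ} (hρ : 0 < ρ) (hx : dist x x₀ < ρ) (hy : ρ < dist y x₀) :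
    0 ≤ poissonKer d α x₀ ρ x y := by
  have h1 : 0 < dist y x₀ ^ 2 - ρ ^ 2 := by nlinarith
  have h3 : 0 ≤ ρ ^ 2 - dist x x₀ ^ 2 := by nlinarith [dist_nonneg (x := x) (y := x₀)]
  unfold poissonKer
  positivity

/-- A nonnegative function bounded below on finitely many disjoint pieces has integral at least
the sum of the corresponding masses. -/
theorem sum_mul_measureReal_le_setIntegral {X ι : Type*} [MeasurableSpace X] {μ : Measure X}
    {F : X → ℝ} {A : Set X} (hF : IntegrableOn F A μ) (hA : MeasurableSet A)
    (h0 : ∀ x ∈ A, 0 ≤ F x) (s : Finset ι) (T : ι → Set X) (c : ι → ℝ)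
    (hT : ∀ i ∈ s, MeasurableSet (T i)) (hTA : ∀ i ∈ s, T i ⊆ A) (hμ : ∀ i ∈ s, μ (T i) ≠ ⊤)
    (hd : (s : Set ι).Pairwise (Function.onFun Disjoint T))
    (hc : ∀ i ∈ s, ∀ x ∈ T i, c i ≤ F x) :
    ∑ i ∈ s, c i * μ.real (T i) ≤ ∫ x in A, F x ∂μ := by
  calc ∑ i ∈ s, c i * μ.real (T i) ≤ ∑ i ∈ s, ∫ x in T i, F x ∂μ :=
        Finset.sum_le_sum fun i hi =>
          setIntegral_ge_of_const_le_real (hT i hi) (hμ i hi) (hc i hi) (hF.mono_set (hTA i hi))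
    _ = ∫ x in ⋃ i ∈ s, T i, F x ∂μ :=
        (integral_biUnion_finset s hT hd fun i hi => hF.mono_set (hTA i hi)).symm
    _ ≤ ∫ x in A, F x ∂μ := by
        refine setIntegral_mono_set hF ?_ ?_
        · exact (ae_restrict_mem hA).mono fun x hx => h0 x hx
        · exact (Set.iUnion₂_subset hTA).eventuallyLE

theorem measurableSet_lt_dist {d : ℕ} (x₀ : EuclideanSpace ℝ (Fin d)) (ρ : ℝ) :
    MeasurableSet {y : EuclideanSpace ℝ (Fin d) | ρ < dist y x₀} :=
  (isOpen_lt continuous_const (by fun_prop)).measurableSet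

theorem AlphaHarmonicOn.sum_le {d : ℕ} (hd : 0 < d) {α : ℝ} (hα : α ∈ Set.Ioo (0 : ℝ) 2)
    {h : EuclideanSpace ℝ (Fin d) → ℝ} {U : Set (EuclideanSpace ℝ (Fin d))}
    (hh : AlphaHarmonicOn d α h U) (h0 : ∀ x, 0 ≤ h x)
    {x₀ x : EuclideanSpace ℝ (Fin d)} {ρ : ℝ} (hρ : 0 < ρ) (hsub : closedBall x₀ ρ ⊆ U)
    (hx : dist x x₀ < ρ) {ι : Type*} (s : Finset ι) (T : ι → Set (EuclideanSpace ℝ (Fin d)))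
    (p m : ι → ℝ)
    (hT : ∀ i ∈ s, MeasurableSet (T i)) (hTA : ∀ i ∈ s, ∀ y ∈ T i, ρ < dist y x₀)
    (hμ : ∀ i ∈ s, volume (T i) ≠ ⊤)
    (hdis : (s : Set ι).Pairwise (Function.onFun Disjoint T))
    (hp0 : ∀ i ∈ s, 0 ≤ m i)
    (hp : ∀ i ∈ s, ∀ y ∈ T i, p i ≤ poissonKer d α x₀ ρ x y)
    (hm : ∀ i ∈ s, ∀ y ∈ T i, m i ≤ h y) :
    poissonConst d α * ∑ i ∈ s, p i * m i * volume.real (T i) ≤ h x := by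
  obtain ⟨h1, h2⟩ := hh x₀ ρ hρ hsub x hx
  rw [h2]
  refine mul_le_mul_of_nonneg_left ?_ (poissonConst_pos hd hα).le
  refine sum_mul_measureReal_le_setIntegral h1 (measurableSet_lt_dist x₀ ρ) ?_ s T _ hT hTA hμ
    hdis ?_
  · intro y hy
    exact mul_nonneg (poissonKer_nonneg (α := α) hρ hx hy) (h0 y)
  · intro i hi y hy
    exact mul_le_mul (hp i hi y hy) (hm i hi y hy) (hp0 i hi)
      (poissonKer_nonneg (α := α) hρ hx (hTA i hi y hy))

/-- Harnack's inequality in a ball. -/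
theorem AlphaHarmonicOn.harnack {d : ℕ} (hd : 0 < d) {α : ℝ} (hα : α ∈ Set.Ioo (0 : ℝ) 2)
    {h : EuclideanSpace ℝ (Fin d) → ℝ} {U : Set (EuclideanSpace ℝ (Fin d))}
    (hh : AlphaHarmonicOn d α h U) (h0 : ∀ x, 0 ≤ h x)
    {x₀ x : EuclideanSpace ℝ (Fin d)} {ρ θ : ℝ} (hρ : 0 < ρ) (hsub : closedBall x₀ ρ ⊆ U)
    (hθ0 : 0 ≤ θ) (hθ1 : θ < 1) (hx : dist x x₀ ≤ θ * ρ) :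
    (1 - θ ^ 2) ^ (α / 2) * (1 + θ) ^ (-(d : ℝ)) * h x₀ ≤ h x := by
  have hxρ : dist x x₀ < ρ := by nlinarith
  obtain ⟨h1, h2⟩ := hh x₀ ρ hρ hsub x₀ (by simpa using hρ)
  obtain ⟨h3, h4⟩ := hh x₀ ρ hρ hsub x hxρ
  have key : (1 - θ ^ 2) ^ (α / 2) * (1 + θ) ^ (-(d : ℝ)) *
      (∫ y in {y | ρ < dist y x₀}, poissonKer d α x₀ ρ x₀ y * h y) ≤
      ∫ y in {y | ρ < dist y x₀}, poissonKer d α x₀ ρ x y * h y := by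
    rw [← integral_const_mul]
    refine setIntegral_mono_on (Integrable.const_mul h1 _) h3 (measurableSet_lt_dist x₀ ρ) ?_
    intro y hy
    have hy : ρ < dist y x₀ := hy
    rw [← mul_assoc]
    refine mul_le_mul_of_nonneg_right ?_ (h0 y)
    have e1 : 0 < dist y x₀ ^ 2 - ρ ^ 2 := by nlinarith
    have e2 : 0 ≤ 1 - θ ^ 2 := by nlinarith
    have hb : dist x y ≤ (1 + θ) * dist x₀ y := by
      have := dist_triangle x x₀ y
      rw [dist_comm y x₀] at hy
      nlinarith
    refine le_trans (le_of_eq ?_) (le_poissonKer hα.1 (a := (1 - θ ^ 2) * ρ ^ 2) (by positivity)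
      ?_ hρ hxρ hy le_rfl hb)
    · unfold poissonKer
      rw [dist_self, mul_div_assoc, Real.mul_rpow e2 (by positivity),
        Real.mul_rpow (by positivity) dist_nonneg]
      simp only [ne_eq, OfNat.ofNat_ne_zero, not_false_eq_true, zero_pow, sub_zero]
      ring
    · nlinarith [dist_nonneg (x := x) (y := x₀), mul_self_le_mul_self dist_nonneg hx]
  have hK := (poissonConst_pos hd hα).le
  calc _ = poissonConst d α * ((1 - θ ^ 2) ^ (α / 2) * (1 + θ) ^ (-(d : ℝ)) *
      (∫ y in {y | ρ < dist y x₀}, poissonKer d α x₀ ρ x₀ y * h y)) := by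
        rw [h2]; unfold poissonKer poissonConst; ring
    _ ≤ _ := mul_le_mul_of_nonneg_left key hK
    _ = h x := h4.symm

theorem volume_real_ball {d : ℕ} (hd : 0 < d) (x : EuclideanSpace ℝ (Fin d)) {r : ℝ}
    (hr : 0 ≤ r) :
    volume.real (ball x r) = r ^ d * volume.real (ball (0 : EuclideanSpace ℝ (Fin d)) 1) := by
  have : Nonempty (Fin d) := ⟨⟨0, hd⟩⟩
  rw [measureReal_def, Measure.addHaar_ball _ _ hr, ENNReal.toReal_mul,
    ENNReal.toReal_ofReal (by positivity), measureReal_def]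
  simp

theorem volume_real_ball_one_pos (d : ℕ) :
    0 < volume.real (ball (0 : EuclideanSpace ℝ (Fin d)) 1) :=
  ENNReal.toReal_pos (measure_ball_pos _ _ one_pos).ne' measure_ball_lt_top.ne

/-- The open box with sides `(a i, b i)`. -/
def openBox {d : ℕ} (a b : Fin d → ℝ) : Set (EuclideanSpace ℝ (Fin d)) :=
  {y | ∀ i, y i ∈ Set.Ioo (a i) (b i)}

theorem openBox_eq {d : ℕ} (a b : Fin d → ℝ) : openBox a b =
    (WithLp.ofLp : EuclideanSpace ℝ (Fin d) → _) ⁻¹' (Set.univ.pi fun i => Set.Ioo (a i) (b i)) := by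
  ext y
  simp [openBox, Set.mem_pi]

theorem measurableSet_openBox {d : ℕ} (a b : Fin d → ℝ) : MeasurableSet (openBox a b) := by
  rw [openBox_eq]
  exact (PiLp.volume_preserving_ofLp (Fin d)).measurable
    (MeasurableSet.univ_pi fun i => measurableSet_Ioo)

theorem volume_openBox {d : ℕ} (a b : Fin d → ℝ) :
    volume (openBox a b) = ∏ i, ENNReal.ofReal (b i - a i) := by
  rw [openBox_eq, (PiLp.volume_preserving_ofLp (Fin d)).measure_preimage
    (MeasurableSet.univ_pi fun i => measurableSet_Ioo).nullMeasurableSet, Real.volume_pi_Ioo]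

theorem volume_openBox_ne_top {d : ℕ} (a b : Fin d → ℝ) : volume (openBox a b) ≠ ⊤ := by
  rw [volume_openBox]
  exact ENNReal.prod_ne_top fun i _ => ENNReal.ofReal_ne_top

theorem volume_real_openBox {d : ℕ} (a b : Fin d → ℝ) (hab : ∀ i, a i ≤ b i) :
    volume.real (openBox a b) = ∏ i, (b i - a i) := by
  rw [measureReal_def, volume_openBox, ENNReal.toReal_prod]
  exact Finset.prod_congr rfl fun i _ => ENNReal.toReal_ofReal (sub_nonneg.2 (hab i))

/-- The point `t • e_d`. -/
noncomputable def axisPt (d : ℕ) (h0 : 0 < d) (t : ℝ) : EuclideanSpace ℝ (Fin d) :=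
  EuclideanSpace.single ⟨d - 1, Nat.sub_lt h0 Nat.one_pos⟩ t

theorem dist_axisPt {d : ℕ} (h0 : 0 < d) (s t : ℝ) :
    dist (axisPt d h0 s) (axisPt d h0 t) = |s - t| := by
  unfold axisPt
  rw [EuclideanSpace.single, EuclideanSpace.single, PiLp.dist_single_same, Real.dist_eq]

theorem norm_axisPt {d : ℕ} (h0 : 0 < d) (s : ℝ) : ‖axisPt d h0 s‖ = |s| := by
  unfold axisPt
  rw [EuclideanSpace.single, PiLp.norm_single, Real.norm_eq_abs]

theorem abs_sub_apply_le_dist {d : ℕ} (x y : EuclideanSpace ℝ (Fin d)) (i : Fin d) :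
    |x i - y i| ≤ dist x y := by
  rw [dist_eq_norm]
  simpa using PiLp.norm_apply_le (x - y) i

theorem axisPt_last {d : ℕ} (h0 : 0 < d) (t : ℝ) :
    (axisPt d h0 t) ⟨d - 1, Nat.sub_lt h0 Nat.one_pos⟩ = t := by
  simp [axisPt]

theorem axisPt_first {d : ℕ} (hd : 2 ≤ d) (h0 : 0 < d) (t : ℝ) :
    (axisPt d h0 t) ⟨0, h0⟩ = 0 := by
  have : d - 1 ≠ 0 := by omega
  simp [axisPt, Fin.ext_iff, this.symm]

theorem norm_le_of_forall_abs_le {d : ℕ} {y : EuclideanSpace ℝ (Fin d)} {b : ℝ} (hb : 0 ≤ b)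
    (hy : ∀ i, |y i| ≤ b) : ‖y‖ ≤ d * b := by
  rcases Nat.eq_zero_or_pos d with rfl | hd
  · simp [EuclideanSpace.norm_eq]
  rw [EuclideanSpace.norm_eq]
  apply Real.sqrt_le_iff.2 ⟨by positivity, ?_⟩
  have hd1 : (1 : ℝ) ≤ d := by exact_mod_cast hd
  calc ∑ i, ‖y i‖ ^ 2 ≤ ∑ _i : Fin d, b ^ 2 := by
        refine Finset.sum_le_sum fun i _ => ?_
        exact pow_le_pow_left₀ (norm_nonneg _) (hy i) 2
    _ = d * b ^ 2 := by simp
    _ ≤ (d * b) ^ 2 := by nlinarith [sq_nonneg b, mul_nonneg (sub_nonneg.2 hd1) (sq_nonneg b)]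

theorem mem_Dm_of_last_pos {d : ℕ} (h0 : 0 < d) {ℓ : ℝ → ℝ} (hpos : ∀ r : ℝ, 0 < r → 0 < ℓ r)
    {x : EuclideanSpace ℝ (Fin d)} (hx : 0 < x ⟨d - 1, Nat.sub_lt h0 Nat.one_pos⟩) :
    x ∈ Dm d h0 ℓ := by
  have : 0 ≤ gEll ℓ (x ⟨0, h0⟩) := by
    unfold gEll
    split_ifs with h
    · have := hpos _ h
      positivity
    · exact le_rfl
  change -gEll ℓ (x ⟨0, h0⟩) < _
  linarith

/-- Balls in the upper half-space centred on the axis lie in `D_{-ℓ} ∩ B(0, R)`. -/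
theorem closedBall_axisPt_subset {d : ℕ} (h0 : 0 < d) {ℓ : ℝ → ℝ}
    (hpos : ∀ r : ℝ, 0 < r → 0 < ℓ r) {t ρ R : ℝ} (ht : 0 < t) (hρ : ρ < t) (hR : t + ρ < R) :
    closedBall (axisPt d h0 t) ρ ⊆ Dm d h0 ℓ ∩ ball 0 R := by
  intro v hv
  have hv : dist v (axisPt d h0 t) ≤ ρ := hv
  constructor
  · apply mem_Dm_of_last_pos h0 hpos
    have := abs_sub_apply_le_dist v (axisPt d h0 t) ⟨d - 1, Nat.sub_lt h0 Nat.one_pos⟩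
    rw [axisPt_last] at this
    have := neg_abs_le (v ⟨d - 1, Nat.sub_lt h0 Nat.one_pos⟩ - t)
    linarith
  · rw [mem_ball]
    have := dist_triangle v (axisPt d h0 t) 0
    rw [dist_zero_right (axisPt d h0 t), norm_axisPt, abs_of_pos ht] at this
    linarith

/-- The Harnack constant between a point and the points at half the radius. -/
noncomputable def harnackConst (d : ℕ) (α : ℝ) : ℝ :=
  (1 - (1 / 2 : ℝ) ^ 2) ^ (α / 2) * (1 + 1 / 2 : ℝ) ^ (-(d : ℝ))

theorem harnackConst_pos (d : ℕ) (α : ℝ) : 0 < harnackConst d α := by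
  unfold harnackConst
  have : (0 : ℝ) < 1 - (1 / 2 : ℝ) ^ 2 := by norm_num
  positivity

theorem AlphaHarmonicOn.harnack_axisPt {d : ℕ} (h0 : 0 < d) {α : ℝ} (hα : α ∈ Set.Ioo (0 : ℝ) 2)
    {ℓ : ℝ → ℝ} (hpos : ∀ r : ℝ, 0 < r → 0 < ℓ r) {R : ℝ}
    {h : EuclideanSpace ℝ (Fin d) → ℝ} (hh : AlphaHarmonicOn d α h (Dm d h0 ℓ ∩ ball 0 R))
    (hn : ∀ x, 0 ≤ h x) {t : ℝ} (ht : 0 < t) (htR : t ≤ R / 2) {y : EuclideanSpace ℝ (Fin d)}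
    (hy : dist y (axisPt d h0 t) ≤ t / 4) :
    harnackConst d α * h (axisPt d h0 t) ≤ h y :=
  hh.harnack h0 hα hn (ρ := t / 2) (θ := 1 / 2) (by positivity)
    (closedBall_axisPt_subset h0 hpos ht (by linarith) (by linarith)) (by norm_num) (by norm_num)
    (by linarith)

/-- The box at scale `s` lying between the hyperplane `x_d = 0` and the boundary of `D_{-ℓ}`. -/
noncomputable def slabBox (d : ℕ) (h0 : 0 < d) (s w : ℝ) : Set (EuclideanSpace ℝ (Fin d)) :=
  openBox (fun i => if i = ⟨d - 1, Nat.sub_lt h0 Nat.one_pos⟩ then -(s * w / 4) else 2 * s)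
    (fun i => if i = ⟨d - 1, Nat.sub_lt h0 Nat.one_pos⟩ then 0 else 3 * s)

theorem volume_real_slabBox {d : ℕ} (h0 : 0 < d) {s w : ℝ} (hs : 0 < s) (hw : 0 < w) :
    volume.real (slabBox d h0 s w) = s ^ d * w / 4 := by
  have hsw : 0 < s * w := mul_pos hs hw
  unfold slabBox
  rw [volume_real_openBox]
  · have : ∀ i : Fin d, ((if i = ⟨d - 1, Nat.sub_lt h0 Nat.one_pos⟩ then 0 else 3 * s) -
        if i = ⟨d - 1, Nat.sub_lt h0 Nat.one_pos⟩ then -(s * w / 4) else 2 * s) =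
        s * if i = ⟨d - 1, Nat.sub_lt h0 Nat.one_pos⟩ then w / 4 else 1 := by
      intro i
      split_ifs <;> ring
    simp_rw [this]
    rw [Finset.prod_mul_distrib, Finset.prod_ite_eq']
    simp
    ring
  · intro i
    split_ifs <;> linarith

theorem slabBox_last {d : ℕ} {h0 : 0 < d} {s w : ℝ} {y : EuclideanSpace ℝ (Fin d)}
    (hy : y ∈ slabBox d h0 s w) :
    -(s * w / 4) < y ⟨d - 1, Nat.sub_lt h0 Nat.one_pos⟩ ∧
      y ⟨d - 1, Nat.sub_lt h0 Nat.one_pos⟩ < 0 := by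
  simpa using hy ⟨d - 1, Nat.sub_lt h0 Nat.one_pos⟩

theorem slabBox_first {d : ℕ} (hd : 2 ≤ d) {h0 : 0 < d} {s w : ℝ}
    {y : EuclideanSpace ℝ (Fin d)} (hy : y ∈ slabBox d h0 s w) :
    2 * s < y ⟨0, h0⟩ ∧ y ⟨0, h0⟩ < 3 * s := by
  have : ¬ 0 = d - 1 := by omega
  simpa [Fin.ext_iff, this] using hy ⟨0, h0⟩

theorem slabBox_norm_le {d : ℕ} {h0 : 0 < d} {s w : ℝ} (hs : 0 < s) (hw : w ≤ 1)
    {y : EuclideanSpace ℝ (Fin d)} (hy : y ∈ slabBox d h0 s w) : ‖y‖ ≤ 3 * d * s := by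
  have := norm_le_of_forall_abs_le (b := 3 * s) (y := y) (by positivity) (fun i => by
    have hi := hy i
    simp only [Set.mem_Ioo] at hi
    rw [abs_le]
    split_ifs at hi
    · constructor <;> nlinarith
    · constructor <;> linarith)
  linarith

/-- The constant in the lower bound on the slab boxes. -/
noncomputable def slabConst (d : ℕ) (α : ℝ) : ℝ :=
  poissonConst d α * ((1 / (100 * d ^ 2) : ℝ) ^ (α / 2) * (4 * d : ℝ) ^ (-(d : ℝ)) *
    harnackConst d α * ((1 / 4) ^ d * volume.real (ball (0 : EuclideanSpace ℝ (Fin d)) 1)))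

theorem slabConst_pos {d : ℕ} (h0 : 0 < d) {α : ℝ} (hα : α ∈ Set.Ioo (0 : ℝ) 2) :
    0 < slabConst d α := by
  have := poissonConst_pos h0 hα
  have := harnackConst_pos d α
  have := volume_real_ball_one_pos d
  unfold slabConst
  positivity

theorem mul_rpow_neg_natCast {d : ℕ} {a s : ℝ} (ha : 0 ≤ a) (hs : 0 < s) :
    (a * s) ^ (-(d : ℝ)) = a ^ (-(d : ℝ)) * (s ^ d)⁻¹ := by
  rw [Real.mul_rpow ha hs.le, Real.rpow_neg hs.le, Real.rpow_natCast]

theorem AlphaHarmonicOn.slabBox_lower {d : ℕ} (hd : 2 ≤ d) (h0 : 0 < d) {α : ℝ}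
    (hα : α ∈ Set.Ioo (0 : ℝ) 2)
    {ℓ : ℝ → ℝ} (hpos : ∀ r : ℝ, 0 < r → 0 < ℓ r) (hmono : ∀ s r : ℝ, 0 < s → s ≤ r → ℓ s ≤ ℓ r)
    {R : ℝ} {h : EuclideanSpace ℝ (Fin d) → ℝ}
    (hh : AlphaHarmonicOn d α h (Dm d h0 ℓ ∩ ball 0 R))
    (hn : ∀ x, 0 ≤ h x) {s w : ℝ} (hs : 0 < s) (hsR : 16 * d * s ≤ R) (hw0 : 0 < w)
    (hw1 : w ≤ 1) (hwl : w ≤ ℓ s) {y : EuclideanSpace ℝ (Fin d)} (hy : y ∈ slabBox d h0 s w) :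
    slabConst d α * w ^ (α / 2) * h (axisPt d h0 s) ≤ h y := by
  have hd2 : (2 : ℝ) ≤ d := by exact_mod_cast hd
  have hds : 2 * s ≤ d * s := by nlinarith
  have hsw : 0 < s * w := mul_pos hs hw0
  have hsw1 : s * w ≤ s := by nlinarith
  obtain ⟨hl1, hl2⟩ := slabBox_last hy
  obtain ⟨hf1, hf2⟩ := slabBox_first hd hy
  have hny := slabBox_norm_le hs hw1 hy
  set yl := y ⟨d - 1, Nat.sub_lt h0 Nat.one_pos⟩ with hyl
  obtain ⟨δ, hδ⟩ : ∃ δ, δ = s * w / 2 + yl := ⟨_, rfl⟩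
  set z := y + axisPt d h0 (s - δ) with hz
  have hzy : dist y z = s - δ := by
    rw [hz, dist_self_add_right, norm_axisPt, abs_of_nonneg]
    linarith
  have hzl : z ⟨d - 1, Nat.sub_lt h0 Nat.one_pos⟩ = s - s * w / 2 := by
    rw [hz, PiLp.add_apply, axisPt_last, ← hyl]
    linarith
  have hzf : z ⟨0, h0⟩ = y ⟨0, h0⟩ := by
    rw [hz, PiLp.add_apply, axisPt_first hd, add_zero]
  have hz0 : dist z 0 ≤ 3 * d * s + s := by
    have := dist_triangle_left z 0 y
    rw [dist_zero_right y, hzy] at this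
    linarith
  have hsub : closedBall z s ⊆ Dm d h0 ℓ ∩ ball 0 R := by
    intro v hv
    have hv : dist v z ≤ s := hv
    constructor
    · have e1 := abs_sub_apply_le_dist v z ⟨d - 1, Nat.sub_lt h0 Nat.one_pos⟩
      have e2 := abs_sub_apply_le_dist v z ⟨0, h0⟩
      rw [hzl] at e1
      rw [hzf] at e2
      have e3 := (abs_le.1 (e1.trans hv)).1
      have e4 := (abs_le.1 (e2.trans hv)).1
      have e5 : s < v ⟨0, h0⟩ := by linarith
      change -gEll ℓ (v ⟨0, h0⟩) < _
      rw [gEll, if_pos (hs.trans e5)]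
      have e6 : s * w ≤ v ⟨0, h0⟩ * ℓ (v ⟨0, h0⟩) :=
        mul_le_mul e5.le (hwl.trans (hmono _ _ hs e5.le)) hw0.le (hs.trans e5).le
      linarith
    · rw [mem_ball]
      have := dist_triangle v z 0
      linarith
  have hball : ∀ u ∈ ball (axisPt d h0 s) (s / 4), dist u z ≤ 5 * d * s ∧ dist y u ≤ 4 * d * s ∧
      s < dist u z := by
    intro u hu
    have hu : dist u (axisPt d h0 s) < s / 4 := hu
    have e1 : dist u 0 ≤ s / 4 + s := by
      have := dist_triangle u (axisPt d h0 s) 0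
      rw [dist_zero_right (axisPt d h0 s), norm_axisPt, abs_of_pos hs] at this
      linarith
    refine ⟨?_, ?_, ?_⟩
    · have := dist_triangle_right u z 0
      linarith
    · have := dist_triangle_right y u 0
      rw [dist_zero_right y] at this
      linarith
    · have e2 := abs_sub_apply_le_dist u z ⟨0, h0⟩
      have e3 := abs_sub_apply_le_dist u (axisPt d h0 s) ⟨0, h0⟩
      rw [hzf] at e2
      rw [axisPt_first hd] at e3
      have e4 := (abs_le.1 e2).1
      have e5 := (abs_le.1 e3).2
      linarith
  have hδ1 : s * w / 4 ≤ δ := by linarith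
  have hδ2 : δ ≤ s := by linarith
  have key := hh.sum_le h0 hα hn (x₀ := z) (x := y) hs hsub (by rw [hzy]; linarith)
    {()} (fun _ => ball (axisPt d h0 s) (s / 4))
    (fun _ => (s ^ 2 * w / 4 / (25 * d ^ 2 * s ^ 2)) ^ (α / 2) * (4 * d * s) ^ (-(d : ℝ)))
    (fun _ => harnackConst d α * h (axisPt d h0 s))
    (fun _ _ => measurableSet_ball) (fun _ _ u hu => (hball u hu).2.2)
    (fun _ _ => measure_ball_lt_top.ne) (by simp)
    (fun _ _ => mul_nonneg (harnackConst_pos d α).le (hn _))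
    (fun _ _ u hu => le_poissonKer hα.1 (by positivity)
      (by rw [hzy]; nlinarith) hs (by rw [hzy]; linarith) (hball u hu).2.2
      (by nlinarith [(hball u hu).1, dist_nonneg (x := u) (y := z),
        mul_self_le_mul_self dist_nonneg (hball u hu).1]) (hball u hu).2.1)
    (fun _ _ u hu => hh.harnack_axisPt h0 hα hpos hn hs (by nlinarith) (le_of_lt hu))
  refine le_trans (le_of_eq ?_) key
  rw [Finset.sum_singleton, volume_real_ball h0 _ (by positivity), mul_rpow_neg_natCast
    (by positivity) hs]
  have e1 : s ^ 2 * w / 4 / (25 * d ^ 2 * s ^ 2) = 1 / (100 * (d : ℝ) ^ 2) * w := by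
    field_simp
    norm_num
  have e2 : (s / 4) ^ d = s ^ d * (1 / 4) ^ d := by rw [← mul_pow]; congr 1; ring
  rw [e1, Real.mul_rpow (by positivity) hw0.le, e2]
  have e3 : s ^ d ≠ 0 := by positivity
  unfold slabConst
  field_simp

/-- The constant in the contribution of the top scale. -/
noncomputable def topConst (d : ℕ) (α : ℝ) : ℝ :=
  poissonConst d α * ((1 / 16 : ℝ) ^ (α / 2) * (1 / 8) ^ d * harnackConst d α *
    volume.real (ball (0 : EuclideanSpace ℝ (Fin d)) 1))

/-- The constant in the contribution of the intermediate scales. -/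
noncomputable def stepConst (d : ℕ) (α : ℝ) : ℝ :=
  poissonConst d α * ((1 / (2 * (1 + 9 * d ^ 2)) : ℝ) ^ (α / 2) * (4 * d : ℝ) ^ (-(d : ℝ)) *
    slabConst d α / 4)

theorem topConst_pos {d : ℕ} (h0 : 0 < d) {α : ℝ} (hα : α ∈ Set.Ioo (0 : ℝ) 2) :
    0 < topConst d α := by
  have := poissonConst_pos h0 hα
  have := harnackConst_pos d α
  have := volume_real_ball_one_pos d
  unfold topConst
  positivity

theorem stepConst_pos {d : ℕ} (h0 : 0 < d) {α : ℝ} (hα : α ∈ Set.Ioo (0 : ℝ) 2) :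
    0 < stepConst d α := by
  have := poissonConst_pos h0 hα
  have := slabConst_pos h0 hα
  unfold stepConst
  positivity

theorem rpow_scale_bound {D r s w ρ β : ℝ} (hD : 0 < D) (hr : 0 < r) (hs : 0 < s) (hw : 0 < w)
    (hρ : 0 < ρ) (hβ : 0 < β) :
    (1 / (2 * (1 + D))) ^ β * (r / s) ^ β * max (w - s / ρ) 0 ≤
      (r * ρ / 2 / (ρ * s * w + D * s ^ 2)) ^ β * w ^ β * w := by
  rcases le_or_gt (w - s / ρ) 0 with hc | hc
  · rw [max_eq_right hc, mul_zero]
    positivity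
  · rw [max_eq_left hc.le]
    have hsw : s ≤ ρ * w := by
      have : s / ρ ≤ w := by linarith
      rw [div_le_iff₀ hρ] at this
      linarith
    have e1 : 1 / (2 * (1 + D)) * (r / s) ≤ r * ρ / 2 / (ρ * s * w + D * s ^ 2) * w := by
      rw [div_mul_div_comm, div_mul_eq_mul_div, div_le_div_iff₀ (by positivity) (by positivity)]
      have : 0 ≤ r * s * D * (ρ * w - s) := by
        have := sub_nonneg.2 hsw
        positivity
      nlinarith
    rw [← Real.mul_rpow (by positivity) (by positivity),
      ← Real.mul_rpow (by positivity) (by positivity)]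
    have : 0 < s / ρ := by positivity
    exact mul_le_mul (Real.rpow_le_rpow (by positivity) e1 hβ.le) (by linarith) hc.le
      (by positivity)

theorem AlphaHarmonicOn.scale_sum_le {d : ℕ} (hd : 2 ≤ d) (h0 : 0 < d) {α : ℝ}
    (hα : α ∈ Set.Ioo (0 : ℝ) 2)
    {ℓ : ℝ → ℝ} (hpos : ∀ r : ℝ, 0 < r → 0 < ℓ r) (hmono : ∀ s r : ℝ, 0 < s → s ≤ r → ℓ s ≤ ℓ r)
    {R : ℝ} {h : EuclideanSpace ℝ (Fin d) → ℝ}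
    (hh : AlphaHarmonicOn d α h (Dm d h0 ℓ ∩ ball 0 R))
    (hn : ∀ x, 0 ≤ h x) {s w : ℕ → ℝ} {k : ℕ} (hs : ∀ j, 0 < s j)
    (hsR : ∀ j, 16 * d * s j ≤ R) (hs2 : ∀ i j, i < j → s j ≤ s i / 2)
    (hw0 : ∀ j, 0 < w j) (hwanti : Antitone w)
    (hw1 : ∀ j, w j ≤ 1) (hwl : ∀ j, w j ≤ ℓ (s j)) :
    topConst d α * (s k / R) ^ (α / 2) * h (axisPt d h0 (R / 2)) +
      ∑ j ∈ Finset.range k, stepConst d α * (s k / s j) ^ (α / 2) *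
        max (w j - s j / (R / 8)) 0 * h (axisPt d h0 (s j)) ≤ h (axisPt d h0 (s k)) := by
  have hd2 : (2 : ℝ) ≤ d := by exact_mod_cast hd
  obtain ⟨ρ, hρR⟩ : ∃ ρ, R = 8 * ρ := ⟨R / 8, by ring⟩
  obtain ⟨r, hr⟩ : ∃ r, r = s k := ⟨_, rfl⟩
  have hr0 : 0 < r := hr ▸ hs k
  have h4r : 4 * r ≤ ρ := by
    have := hsR k
    rw [← hr] at this
    nlinarith
  have hρ : 0 < ρ := by linarith
  obtain ⟨ε, hε⟩ : ∃ ε, ε = r * w k / 4 := ⟨_, rfl⟩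
  have hε0 : 0 < ε := by have := hw0 k; rw [hε]; positivity
  have hεr : ε ≤ r / 4 := by have := hw1 k; rw [hε]; nlinarith
  have hrs : ∀ j ∈ Finset.range k, r ≤ s j := by
    intro j hj
    have := hs2 j k (Finset.mem_range.1 hj)
    have := hs j
    linarith
  have hεs : ∀ j ∈ Finset.range k, ε ≤ s j * w j / 4 := by
    intro j hj
    have e1 : w k ≤ w j := hwanti (Finset.mem_range.1 hj).le
    have := mul_le_mul (hrs j hj) e1 (hw0 k).le (hs j).le
    rw [hε]; linarith
  have hx : dist (axisPt d h0 r) (axisPt d h0 ρ) = ρ - r := by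
    rw [dist_axisPt, abs_sub_comm, abs_of_nonneg]
    linarith
  have hsub : closedBall (axisPt d h0 ρ) (ρ - ε) ⊆ Dm d h0 ℓ ∩ ball 0 R :=
    closedBall_axisPt_subset h0 hpos hρ (by linarith) (by linarith)
  have htop : ∀ y ∈ ball (axisPt d h0 (R / 2)) (R / 8),
      ρ - ε < dist y (axisPt d h0 ρ) ∧ dist y (axisPt d h0 ρ) ≤ R ∧
      dist (axisPt d h0 r) y ≤ R ∧ 0 < y ⟨d - 1, Nat.sub_lt h0 Nat.one_pos⟩ := by
    intro y hy
    have hy : dist y (axisPt d h0 (R / 2)) < R / 8 := hy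
    have e1 : dist (axisPt d h0 (R / 2)) (axisPt d h0 ρ) = 3 * ρ := by
      rw [dist_axisPt, abs_of_nonneg] <;> linarith
    have e2 : dist (axisPt d h0 r) (axisPt d h0 (R / 2)) = R / 2 - r := by
      rw [dist_axisPt, abs_sub_comm, abs_of_nonneg]
      linarith
    have e3 := abs_sub_apply_le_dist y (axisPt d h0 (R / 2)) ⟨d - 1, Nat.sub_lt h0 Nat.one_pos⟩
    rw [axisPt_last] at e3
    have e4 := (abs_le.1 e3).1
    refine ⟨?_, ?_, ?_, ?_⟩
    · have := dist_triangle_left (axisPt d h0 (R / 2)) (axisPt d h0 ρ) y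
      linarith
    · have := dist_triangle y (axisPt d h0 (R / 2)) (axisPt d h0 ρ)
      linarith
    · have := dist_triangle_right (axisPt d h0 r) y (axisPt d h0 (R / 2))
      linarith
    · linarith
  have hbox : ∀ j ∈ Finset.range k, ∀ y ∈ slabBox d h0 (s j) (w j),
      ρ - ε < dist y (axisPt d h0 ρ) ∧
      dist y (axisPt d h0 ρ) ^ 2 - (ρ - ε) ^ 2 ≤ ρ * s j * w j + 9 * d ^ 2 * s j ^ 2 ∧
      dist (axisPt d h0 r) y ≤ 4 * d * s j := by
    intro j hj y hy
    have hny := slabBox_norm_le (hs j) (hw1 j) hy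
    obtain ⟨hl1, hl2⟩ := slabBox_last hy
    have e0 : dist y (axisPt d h0 ρ) ^ 2 =
        ‖y‖ ^ 2 - 2 * ρ * y ⟨d - 1, Nat.sub_lt h0 Nat.one_pos⟩ + ρ ^ 2 := by
      rw [dist_eq_norm, norm_sub_sq_real, norm_axisPt, sq_abs, axisPt,
        EuclideanSpace.inner_single_right]
      simp
      ring
    have e1 := norm_nonneg y
    have e2 := hs j
    have e3 := hεs j hj
    refine ⟨?_, ?_, ?_⟩
    · refine lt_of_pow_lt_pow_left₀ 2 dist_nonneg ?_
      rw [e0]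
      nlinarith [sq_nonneg ‖y‖]
    · rw [e0]
      nlinarith [mul_self_le_mul_self e1 hny]
    · have := dist_triangle_right (axisPt d h0 r) y 0
      rw [dist_zero_right y, dist_zero_right, norm_axisPt, abs_of_pos hr0] at this
      have := hrs j hj
      nlinarith
  have key := hh.sum_le h0 hα hn (x₀ := axisPt d h0 ρ) (x := axisPt d h0 r) (ρ := ρ - ε)
    (by linarith) hsub (by rw [hx]; linarith) (Finset.insertNone (Finset.range k))
    (fun o => o.elim (ball (axisPt d h0 (R / 2)) (R / 8)) fun j => slabBox d h0 (s j) (w j))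
    (fun o => o.elim ((r * ρ / 2 / R ^ 2) ^ (α / 2) * R ^ (-(d : ℝ))) fun j =>
      (r * ρ / 2 / (ρ * s j * w j + 9 * d ^ 2 * s j ^ 2)) ^ (α / 2) *
        (4 * d * s j) ^ (-(d : ℝ)))
    (fun o => o.elim (harnackConst d α * h (axisPt d h0 (R / 2))) fun j =>
      slabConst d α * w j ^ (α / 2) * h (axisPt d h0 (s j)))
    (by
      rintro (_ | j) -
      · exact measurableSet_ball
      · exact measurableSet_openBox _ _)
    (by
      rintro (_ | j) hj y hy
      · exact (htop y hy).1
      · exact (hbox j (by simpa using hj) y hy).1)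
    (by
      rintro (_ | j) -
      · exact measure_ball_lt_top.ne
      · exact volume_openBox_ne_top _ _)
    (by
      have e1 : ∀ j, Disjoint (ball (axisPt d h0 (R / 2)) (R / 8))
          (slabBox d h0 (s j) (w j)) := fun j => Set.disjoint_left.2 fun y hy hy' =>
        absurd (htop y hy).2.2.2 (slabBox_last hy').2.not_gt
      have e2 : ∀ i j, i < j → Disjoint (slabBox d h0 (s i) (w i)) (slabBox d h0 (s j) (w j)) := by
        intro i j hij
        refine Set.disjoint_left.2 fun y hy hy' => ?_
        have := (slabBox_first hd hy).1
        have := (slabBox_first hd hy').2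
        have := hs2 i j hij
        have := hs i
        linarith
      rintro (_ | i) - (_ | j) - hij
      · exact absurd rfl hij
      · exact e1 j
      · exact (e1 i).symm
      · have hij' : i ≠ j := fun hc => hij (by rw [hc])
        rcases lt_or_gt_of_ne hij' with hc | hc
        · exact e2 i j hc
        · exact (e2 j i hc).symm)
    (by
      rintro (_ | j) -
      · exact mul_nonneg (harnackConst_pos d α).le (hn _)
      · exact mul_nonneg (mul_nonneg (slabConst_pos h0 hα).le
          (Real.rpow_nonneg (hw0 j).le _)) (hn _))
    (by
      have ha : r * ρ / 2 ≤ (ρ - ε) ^ 2 - dist (axisPt d h0 r) (axisPt d h0 ρ) ^ 2 := by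
        rw [hx]
        nlinarith
      rintro (_ | j) hj y hy
      · obtain ⟨t1, t2, t3, -⟩ := htop y hy
        exact le_poissonKer hα.1 (by positivity) ha (by linarith) (by rw [hx]; linarith) t1
          (by nlinarith [mul_self_le_mul_self dist_nonneg t2, sq_nonneg (ρ - ε)]) t3
      · obtain ⟨t1, t2, t3⟩ := hbox j (by simpa using hj) y hy
        exact le_poissonKer hα.1 (by positivity) ha (by linarith) (by rw [hx]; linarith) t1 t2 t3)
    (by
      rintro (_ | j) hj y hy
      · exact hh.harnack_axisPt h0 hα hpos hn (by linarith) le_rfl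
          (le_of_lt (lt_of_lt_of_eq (mem_ball.1 hy) (by ring)))
      · exact hh.slabBox_lower hd h0 hα hpos hmono hn (hs j) (hsR j) (hw0 j) (hw1 j) (hwl j) hy)
  rw [Finset.sum_insertNone, mul_add, Finset.mul_sum] at key
  simp only [Option.elim] at key
  rw [← hr]
  refine le_trans (add_le_add (le_of_eq ?_) (Finset.sum_le_sum fun j hj => ?_)) key
  · have hR0 : 0 < R := by linarith
    rw [volume_real_ball h0 _ (by positivity)]
    have e1 : r * ρ / 2 / R ^ 2 = 1 / 16 * (r / R) := by
      rw [hρR]; field_simp; norm_num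
    have e2 : (R / 8) ^ d = R ^ d * (1 / 8) ^ d := by rw [← mul_pow]; congr 1; ring
    rw [e1, Real.mul_rpow (by positivity) (by positivity), e2, Real.rpow_neg hR0.le,
      Real.rpow_natCast]
    have e3 : R ^ d ≠ 0 := by positivity
    unfold topConst
    field_simp
  · have hsj := hs j
    rw [volume_real_slabBox h0 hsj (hw0 j), mul_rpow_neg_natCast (by positivity) hsj]
    have e1 := rpow_scale_bound (D := 9 * (d : ℝ) ^ 2) (by positivity) hr0 hsj (hw0 j) hρ
      (half_pos hα.1)
    have e3 : s j ^ d ≠ 0 := by positivity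
    have e4 : 0 ≤ poissonConst d α * (4 * d : ℝ) ^ (-(d : ℝ)) * slabConst d α / 4 *
        h (axisPt d h0 (s j)) := by
      have := poissonConst_pos h0 hα
      have := slabConst_pos h0 hα
      have := hn (axisPt d h0 (s j))
      positivity
    have e5 := mul_le_mul_of_nonneg_right e1 e4
    have e6 : R / 8 = ρ := by linarith
    rw [e6]
    refine le_trans (le_of_eq ?_) (e5.trans (le_of_eq ?_))
    · unfold stepConst; ring
    · field_simp

theorem mul_prod_one_add_le {M q : ℕ → ℝ} {A : ℝ} (hq : ∀ j, 0 ≤ q j)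
    (hM : ∀ k, A + ∑ j ∈ Finset.range k, q j * M j ≤ M k) (k : ℕ) :
    A * ∏ j ∈ Finset.range k, (1 + q j) ≤ M k := by
  refine le_trans ?_ (hM k)
  induction k with
  | zero => simp
  | succ k ih =>
    rw [Finset.prod_range_succ, Finset.sum_range_succ]
    have h1 := mul_le_mul_of_nonneg_right ih (by linarith [hq k] : (0 : ℝ) ≤ 1 + q k)
    have h2 := mul_le_mul_of_nonneg_left (hM k) (hq k)
    linarith

theorem exp_half_le_one_add {x : ℝ} (h0 : 0 ≤ x) (h1 : x ≤ 1) : Real.exp (x / 2) ≤ 1 + x := by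
  have h2 := Real.exp_bound_div_one_sub_of_interval (x := x / 2) (by linarith) (by linarith)
  refine h2.trans ?_
  rw [div_le_iff₀ (by linarith)]
  nlinarith

theorem intervalIntegrable_div_self {ℓ : ℝ → ℝ} (hcont : ContinuousOn ℓ (Set.Ioi 0)) {a b : ℝ}
    (ha : 0 < a) (hb : 0 < b) : IntervalIntegrable (fun u => ℓ u / u) volume a b := by
  have hsub : Set.uIcc a b ⊆ Set.Ioi 0 := fun u hu => lt_of_lt_of_le (lt_min ha hb) hu.1
  exact ((hcont.mono hsub).div continuousOn_id fun u hu => (hsub hu).ne').intervalIntegrable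

theorem intervalIntegral_div_self_le {ℓ : ℝ → ℝ} (hcont : ContinuousOn ℓ (Set.Ioi 0))
    (hpos : ∀ r : ℝ, 0 < r → 0 < ℓ r) (hmono : ∀ s r : ℝ, 0 < s → s ≤ r → ℓ s ≤ ℓ r)
    {a b : ℝ} (ha : 0 < a) (hab : a ≤ b) : ∫ u in a..b, ℓ u / u ≤ ℓ b * ((b - a) / a) := by
  have h1 := intervalIntegral.integral_mono_on hab
    (intervalIntegrable_div_self hcont ha (ha.trans_le hab))
    (intervalIntegrable_const (c := ℓ b / a)) fun u hu =>
      div_le_div₀ (hpos _ (ha.trans_le hab)).le (hmono u b (ha.trans_le hu.1) hu.2) ha hu.1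
  rw [intervalIntegral.integral_const, smul_eq_mul] at h1
  exact h1.trans (le_of_eq (by ring))

theorem intervalIntegral_dyadic_le {ℓ : ℝ → ℝ} (hcont : ContinuousOn ℓ (Set.Ioi 0))
    (hpos : ∀ r : ℝ, 0 < r → 0 < ℓ r) (hmono : ∀ s r : ℝ, 0 < s → s ≤ r → ℓ s ≤ ℓ r)
    {s₀ : ℝ} (hs₀ : 0 < s₀) (k : ℕ) :
    ∫ u in (s₀ / 2 ^ k)..s₀, ℓ u / u ≤ ∑ j ∈ Finset.range k, ℓ (s₀ / 2 ^ j) := by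
  induction k with
  | zero => simp
  | succ k ih =>
    have h1 : 0 < s₀ / 2 ^ k := by positivity
    have h2 : 0 < s₀ / 2 ^ (k + 1) := by positivity
    have h3 : s₀ / 2 ^ k = 2 * (s₀ / 2 ^ (k + 1)) := by rw [pow_succ]; field_simp
    rw [← intervalIntegral.integral_add_adjacent_intervals
      (intervalIntegrable_div_self hcont h2 h1) (intervalIntegrable_div_self hcont h1 hs₀),
      Finset.sum_range_succ, add_comm]
    refine add_le_add ih ?_
    refine (intervalIntegral_div_self_le hcont hpos hmono h2 (by linarith)).trans (le_of_eq ?_)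
    have : (s₀ / 2 ^ k - s₀ / 2 ^ (k + 1)) / (s₀ / 2 ^ (k + 1)) = 1 := by
      rw [div_eq_one_iff_eq h2.ne']
      linarith
    rw [this, mul_one]

theorem sum_dyadic_le {s₀ : ℝ} (hs₀ : 0 < s₀) (k : ℕ) :
    ∑ j ∈ Finset.range k, s₀ / 2 ^ j ≤ 2 * s₀ := by
  have : ∑ j ∈ Finset.range k, s₀ / 2 ^ j = 2 * s₀ - 2 * (s₀ / 2 ^ k) := by
    induction k with
    | zero => simp
    | succ k ih =>
      rw [Finset.sum_range_succ, ih, pow_succ]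
      field_simp
      ring
  have : 0 < s₀ / 2 ^ k := by positivity
  linarith

/-- The lower bound along a dyadic sequence of scales. -/
theorem AlphaHarmonicOn.exp_growth {d : ℕ} (hd : 2 ≤ d) (h0 : 0 < d) {α : ℝ}
    (hα : α ∈ Set.Ioo (0 : ℝ) 2)
    {ℓ : ℝ → ℝ} (hcont : ContinuousOn ℓ (Set.Ioi 0)) (hpos : ∀ r : ℝ, 0 < r → 0 < ℓ r)
    (hmono : ∀ s r : ℝ, 0 < s → s ≤ r → ℓ s ≤ ℓ r)
    {L lam R : ℝ} (hL : 1 ≤ L) (hlL : ℓ R ≤ L) (hlam0 : 0 < lam) (hlam1 : lam ≤ 1)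
    (hlam : lam ≤ stepConst d α) {h : EuclideanSpace ℝ (Fin d) → ℝ}
    (hh : AlphaHarmonicOn d α h (Dm d h0 ℓ ∩ ball 0 R))
    (hn : ∀ x, 0 ≤ h x) {r : ℝ} (hr : 0 < r) (hrR : 16 * d * r ≤ R) :
    topConst d α * Real.exp (-(32 * d + 1)) * (r / R) ^ (α / 2) *
      Real.exp (lam / (2 * L) * ∫ u in r..R, ℓ u / u) * h (axisPt d h0 (R / 2)) ≤
      h (axisPt d h0 r) := by
  have hd2 : (2 : ℝ) ≤ d := by exact_mod_cast hd
  have hL0 : 0 < L := by linarith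
  have hR0 : 0 < R := lt_of_lt_of_le (by positivity) hrR
  obtain ⟨k, hk1, hk2⟩ := exists_nat_pow_near (x := R / (16 * d * r)) (y := 2)
    ((one_le_div (by positivity)).2 hrR) one_lt_two
  rw [le_div_iff₀ (by positivity)] at hk1
  rw [div_lt_iff₀ (by positivity), pow_succ] at hk2
  obtain ⟨s₀, hs₀⟩ : ∃ s₀, s₀ = r * 2 ^ k := ⟨_, rfl⟩
  have hs₀0 : 0 < s₀ := by rw [hs₀]; positivity
  have hs₀R : 16 * d * s₀ ≤ R := by rw [hs₀]; linarith
  have hs₀R' : R ≤ 32 * d * s₀ := by rw [hs₀]; linarith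
  have hs0 : ∀ j : ℕ, 0 < s₀ / 2 ^ j := fun j => by positivity
  have hsle : ∀ j : ℕ, s₀ / 2 ^ j ≤ s₀ := fun j => div_le_self hs₀0.le (one_le_pow₀ one_le_two)
  have hs₀leR : s₀ ≤ R := by nlinarith
  have hanti : ∀ i j : ℕ, i ≤ j → s₀ / 2 ^ j ≤ s₀ / 2 ^ i := fun i j hij =>
    div_le_div_of_nonneg_left hs₀0.le (by positivity) (pow_le_pow_right₀ one_le_two hij)
  have hw0 : ∀ j : ℕ, 0 < ℓ (s₀ / 2 ^ j) / L := fun j => div_pos (hpos _ (hs0 j)) hL0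
  have hw1 : ∀ j : ℕ, ℓ (s₀ / 2 ^ j) / L ≤ 1 := fun j => by
    rw [div_le_one hL0]
    exact (hmono _ _ (hs0 j) ((hsle j).trans hs₀leR)).trans hlL
  have hscale := fun k' => hh.scale_sum_le hd h0 hα hpos hmono hn
    (s := fun j => s₀ / 2 ^ j) (w := fun j => ℓ (s₀ / 2 ^ j) / L) (k := k') hs0
    (fun j => le_trans (by have := hsle j; gcongr) hs₀R)
    (fun i j hij => (hanti (i + 1) j hij).trans (le_of_eq (by rw [pow_succ]; field_simp)))
    hw0 (fun i j hij => div_le_div_of_nonneg_right (hmono _ _ (hs0 j) (hanti i j hij)) hL0.le)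
    hw1 (fun j => div_le_self (hpos _ (hs0 j)).le hL)
  obtain ⟨q, hq⟩ : ∃ q : ℕ → ℝ,
      q = fun j => lam * max (ℓ (s₀ / 2 ^ j) / L - s₀ / 2 ^ j / (R / 8)) 0 := ⟨_, rfl⟩
  have hq0 : ∀ j, 0 ≤ q j := fun j => by rw [hq]; positivity
  have hq1 : ∀ j, q j ≤ 1 := fun j => by
    have e1 : 0 < s₀ / 2 ^ j / (R / 8) := by have := hs0 j; positivity
    have e2 : max (ℓ (s₀ / 2 ^ j) / L - s₀ / 2 ^ j / (R / 8)) 0 ≤ 1 :=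
      max_le (by linarith [hw1 j]) zero_le_one
    rw [hq]
    exact mul_le_one₀ hlam1 (le_max_right _ _) e2
  obtain ⟨A, hA⟩ : ∃ A, A = topConst d α / R ^ (α / 2) * h (axisPt d h0 (R / 2)) := ⟨_, rfl⟩
  have hA0 : 0 ≤ A := by
    have := topConst_pos h0 hα
    have := hn (axisPt d h0 (R / 2))
    rw [hA]; positivity
  have hprod := mul_prod_one_add_le (q := q) (A := A)
    (M := fun j => h (axisPt d h0 (s₀ / 2 ^ j)) / (s₀ / 2 ^ j) ^ (α / 2)) hq0 (fun k' => by
      have e0 : 0 < (s₀ / 2 ^ k') ^ (α / 2) := Real.rpow_pos_of_pos (hs0 k') _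
      rw [le_div_iff₀ e0]
      refine le_trans ?_ (hscale k')
      rw [add_mul, Finset.sum_mul]
      refine add_le_add (le_of_eq ?_) (Finset.sum_le_sum fun j _ => ?_)
      · rw [hA, Real.div_rpow (hs0 k').le hR0.le]
        ring
      · have e1 : 0 ≤ (s₀ / 2 ^ k' / (s₀ / 2 ^ j)) ^ (α / 2) *
            max (ℓ (s₀ / 2 ^ j) / L - s₀ / 2 ^ j / (R / 8)) 0 *
            h (axisPt d h0 (s₀ / 2 ^ j)) := by
          have := hn (axisPt d h0 (s₀ / 2 ^ j))
          positivity
        refine le_trans (le_of_eq ?_) ((mul_le_mul_of_nonneg_right hlam e1).trans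
          (le_of_eq (by ring)))
        rw [hq, Real.div_rpow (hs0 k').le (hs0 j).le]
        ring) k
  have hsk : s₀ / 2 ^ k = r := by rw [hs₀]; field_simp
  simp only [hsk] at hprod
  have hexp : Real.exp (∑ j ∈ Finset.range k, q j / 2) ≤ ∏ j ∈ Finset.range k, (1 + q j) := by
    rw [Real.exp_sum]
    exact Finset.prod_le_prod (fun j _ => (Real.exp_pos _).le)
      fun j _ => exp_half_le_one_add (hq0 j) (hq1 j)
  have hsum : lam / (2 * L) * (∫ u in r..R, ℓ u / u) - (32 * d + 1) ≤
      ∑ j ∈ Finset.range k, q j / 2 := by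
    have e1 := intervalIntegral_dyadic_le hcont hpos hmono hs₀0 k
    have e2 := intervalIntegral_div_self_le hcont hpos hmono hs₀0 hs₀leR
    have e3 : ℓ R * ((R - s₀) / s₀) ≤ L * (32 * d) := by
      refine mul_le_mul hlL ?_ (div_nonneg (by linarith) hs₀0.le) hL0.le
      rw [div_le_iff₀ hs₀0]
      linarith
    rw [hsk] at e1
    have e4 := intervalIntegral.integral_add_adjacent_intervals
      (intervalIntegrable_div_self hcont hr hs₀0) (intervalIntegrable_div_self hcont hs₀0 hR0)
    have e5 : ∑ j ∈ Finset.range k, lam * (ℓ (s₀ / 2 ^ j) / L - s₀ / 2 ^ j / (R / 8)) / 2 ≤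
        ∑ j ∈ Finset.range k, q j / 2 := by
      refine Finset.sum_le_sum fun j _ => ?_
      rw [hq]
      exact div_le_div_of_nonneg_right
        (mul_le_mul_of_nonneg_left (le_max_left _ _) hlam0.le) zero_le_two
    refine le_trans ?_ e5
    rw [← Finset.sum_div, ← Finset.mul_sum, Finset.sum_sub_distrib, ← Finset.sum_div,
      ← Finset.sum_div]
    have e6 : (∑ j ∈ Finset.range k, s₀ / 2 ^ j) / (R / 8) ≤ 1 := by
      rw [div_le_one (by positivity)]
      have := sum_dyadic_le hs₀0 k
      nlinarith
    have e7 : (∫ u in r..R, ℓ u / u) / L - 32 * d ≤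
        (∑ j ∈ Finset.range k, ℓ (s₀ / 2 ^ j)) / L := by
      rw [sub_le_iff_le_add, div_le_iff₀ hL0, add_mul, div_mul_cancel₀ _ hL0.ne']
      linarith
    have e8 : lam / 2 * ((∫ u in r..R, ℓ u / u) / L - (32 * d + 1)) ≤
        lam / 2 * ((∑ j ∈ Finset.range k, ℓ (s₀ / 2 ^ j)) / L -
          (∑ j ∈ Finset.range k, s₀ / 2 ^ j) / (R / 8)) :=
      mul_le_mul_of_nonneg_left (by linarith) (by positivity)
    have e9 : lam / (2 * L) * (∫ u in r..R, ℓ u / u) =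
        lam / 2 * ((∫ u in r..R, ℓ u / u) / L) := by
      field_simp
    rw [e9]
    nlinarith
  have hfin := (mul_le_mul_of_nonneg_left ((Real.exp_le_exp.2 hsum).trans hexp) hA0).trans hprod
  rw [le_div_iff₀ (by positivity), sub_eq_neg_add, Real.exp_add] at hfin
  refine le_trans (le_of_eq ?_) hfin
  rw [hA, Real.div_rpow hr.le hR0.le]
  ring

/-- The lower bound at scales comparable with `R`. -/
theorem exists_mul_le_of_comparable {d : ℕ} (hd : 2 ≤ d) (h0 : 0 < d) {α : ℝ}
    (hα : α ∈ Set.Ioo (0 : ℝ) 2) :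
    ∃ κ : ℝ, 0 < κ ∧ ∀ (ℓ : ℝ → ℝ), (∀ r : ℝ, 0 < r → 0 < ℓ r) → ∀ (R : ℝ)
      (h : EuclideanSpace ℝ (Fin d) → ℝ), 0 < R →
      AlphaHarmonicOn d α h (Dm d h0 ℓ ∩ ball 0 R) → (∀ x, 0 ≤ h x) → ∀ r : ℝ,
      R ≤ 16 * d * r → r ≤ R / 2 → κ * h (axisPt d h0 (R / 2)) ≤ h (axisPt d h0 r) := by
  have hd2 : (2 : ℝ) ≤ d := by exact_mod_cast hd
  obtain ⟨η, hη⟩ : ∃ η : ℝ, η = 1 / (16 * d) := ⟨_, rfl⟩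
  have hη0 : 0 < η := by rw [hη]; positivity
  have hη1 : η < 1 := by
    rw [hη, div_lt_one (by positivity)]
    linarith
  have hηd : η * (16 * d) = 1 := by rw [hη]; field_simp
  have hpos2 : 0 < 1 - (1 - η) ^ 2 := by nlinarith
  have hpos3 : 0 < 1 + (1 - η) := by linarith
  refine ⟨(1 - (1 - η) ^ 2) ^ (α / 2) * (1 + (1 - η)) ^ (-(d : ℝ)), by positivity, ?_⟩
  intro ℓ hpos R h hR hh hn r hr1 hr2
  have hηr : η * R ≤ r := by
    have := mul_le_mul_of_nonneg_left hr1 hη0.le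
    have e : η * (16 * d * r) = r := by rw [← mul_assoc, hηd, one_mul]
    linarith
  refine hh.harnack h0 hα hn (ρ := (1 - η) * (R / 2)) (by nlinarith)
    (closedBall_axisPt_subset h0 hpos (by positivity) (by nlinarith) (by nlinarith))
    (by linarith) (by linarith) ?_
  rw [dist_axisPt, abs_sub_comm, abs_of_nonneg (by linarith)]
  nlinarith [mul_pos hη0 hη0, mul_pos (mul_pos hη0 hη0) hR]

theorem stmt_3 (d : ℕ) (hd : 2 ≤ d) (α : ℝ) (hα : α ∈ Set.Ioo (0 : ℝ) 2) (ℓ : ℝ → ℝ)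
    (hpos : ∀ r : ℝ, 0 < r → 0 < ℓ r)
    (hmono : ∀ s r : ℝ, 0 < s → s ≤ r → ℓ s ≤ ℓ r)
    (hlim : Filter.Tendsto ℓ (nhdsWithin 0 (Set.Ioi 0)) (nhds 0))
    (c : ℝ) (hc : 1 ≤ c)
    (halmost : ∀ s r : ℝ, 0 < s → s ≤ r → ℓ r / r ≤ c * (ℓ s / s))
    (hdiff1 : ∀ r : ℝ, 0 < r → DifferentiableAt ℝ ℓ r)
    (hdiff2 : ∀ r : ℝ, 0 < r → DifferentiableAt ℝ (deriv ℓ) r)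
    (Creg : ℝ) (hCreg : 0 < Creg)
    (hreg : ∀ r : ℝ, 0 < r → r * deriv ℓ r + |r ^ 2 * deriv (deriv ℓ) r| ≤ Creg * ℓ r) :
    ∃ lam C : ℝ, 0 < lam ∧ 1 < C ∧
      ∀ R : ℝ, R ∈ Set.Ioc (0 : ℝ) 1 →
        ∀ h : EuclideanSpace ℝ (Fin d) → ℝ, (∀ x, 0 ≤ h x) →
          AlphaHarmonicOn d α h (Dm d (by omega) ℓ ∩ ball 0 R) →
          (∀ x ∈ ball (0 : EuclideanSpace ℝ (Fin d)) R \ Dm d (by omega) ℓ, h x = 0) →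
          ContinuousOn h (ball (0 : EuclideanSpace ℝ (Fin d)) R) →
          ∀ r : ℝ, r ∈ Set.Ioc (0 : ℝ) (R / 2) →
            C⁻¹ * (r / R) ^ (α / 2) * Real.exp (lam * ∫ u in r..R, ℓ u / u) *
                h (EuclideanSpace.single (⟨d - 1, by omega⟩ : Fin d) (R / 2)) ≤
              h (EuclideanSpace.single (⟨d - 1, by omega⟩ : Fin d) r) := by
  have h0 : 0 < d := by omega
  have hcont : ContinuousOn ℓ (Set.Ioi 0) := fun r hr =>
    (hdiff1 r hr).continuousAt.continuousWithinAt
  obtain ⟨κ, hκ0, hκ⟩ := exists_mul_le_of_comparable hd h0 hα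
  obtain ⟨L, hL⟩ : ∃ L, L = max 1 (ℓ 1) := ⟨_, rfl⟩
  have hL1 : 1 ≤ L := hL ▸ le_max_left _ _
  have hL0 : 0 < L := by linarith
  obtain ⟨lam, hlam⟩ : ∃ lam, lam = min 1 (stepConst d α) := ⟨_, rfl⟩
  have hlam0 : 0 < lam := hlam ▸ lt_min one_pos (stepConst_pos h0 hα)
  have hlam1 : lam ≤ 1 := hlam ▸ min_le_left _ _
  obtain ⟨a, ha⟩ : ∃ a, a = topConst d α * Real.exp (-(32 * d + 1)) := ⟨_, rfl⟩
  obtain ⟨b, hb⟩ : ∃ b, b = κ * Real.exp (-(16 * d)) := ⟨_, rfl⟩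
  have ha0 : 0 < a := by have := topConst_pos h0 hα; rw [ha]; positivity
  have hb0 : 0 < b := by rw [hb]; positivity
  have ha0' := inv_pos.2 ha0
  have hb0' := inv_pos.2 hb0
  refine ⟨lam / (2 * L), 1 + a⁻¹ + b⁻¹, by positivity, by linarith, ?_⟩
  have hCa : (1 + a⁻¹ + b⁻¹)⁻¹ ≤ a := inv_le_of_inv_le₀ ha0 (by linarith)
  have hCb : (1 + a⁻¹ + b⁻¹)⁻¹ ≤ b := inv_le_of_inv_le₀ hb0 (by linarith)
  rintro R ⟨hR0, hR1⟩ h hn hh - - r ⟨hr0, hr2⟩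
  have hlL : ℓ R ≤ L := (hmono R 1 hR0 hR1).trans (hL ▸ le_max_right _ _)
  have hhR := hn (axisPt d h0 (R / 2))
  change _ * h (axisPt d h0 (R / 2)) ≤ h (axisPt d h0 r)
  rcases le_total (16 * d * r) R with hc' | hc'
  · refine le_trans ?_ (hh.exp_growth hd h0 hα hcont hpos hmono hL1 hlL hlam0 hlam1
      (hlam ▸ min_le_right _ _) hn hr0 hc')
    rw [← ha]
    gcongr
  · refine le_trans ?_ (hκ ℓ hpos R h hR0 hh hn r hc' hr2)
    refine mul_le_mul_of_nonneg_right ?_ hhR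
    have e1 : (r / R) ^ (α / 2) ≤ 1 :=
      Real.rpow_le_one (by positivity) ((div_le_one hR0).2 (by linarith)) (by linarith [hα.1])
    have e2 : (∫ u in r..R, ℓ u / u) ≤ L * (16 * d) := by
      refine (intervalIntegral_div_self_le hcont hpos hmono hr0 (by linarith)).trans ?_
      refine mul_le_mul hlL ?_ (div_nonneg (by linarith) hr0.le) hL0.le
      rw [div_le_iff₀ hr0]
      linarith
    have e3 : lam / (2 * L) * (∫ u in r..R, ℓ u / u) ≤ 16 * d := by
      refine (mul_le_mul_of_nonneg_left e2 (by positivity)).trans ?_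
      rw [div_mul_eq_mul_div, div_le_iff₀ (by positivity)]
      have : 0 ≤ L * d := by positivity
      nlinarith
    calc _ ≤ b * 1 * Real.exp (16 * d) := by gcongr
      _ = κ := by
        rw [hb, mul_one, mul_assoc, ← Real.exp_add]
        simp
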